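/- The map Θ : Hom_W(V*, Q_m) → D_m^W given by Θ(φ) = Σ_{i=1}^N φ(x_i) ∂_{x_i} is well defined (its image lies in the W-invariant part D_m^W of D_m) and is a linear bijection, with inverse sending L = Σ_{i=1}^N f_i ∂_{x_i} to the map x_k ↦ f_k. -/

import Mathlib

open MvPolynomial

noncomputable section

/-- Action of a matrix `M` on polynomials by linear substitution of the variables. -/
def polyActM {N : ℕ} (M : Matrix (Fin N) (Fin N) ℂ) (p : MvPolynomial (Fin N) ℂ) :
    MvPolynomial (Fin N) ℂ :=
  MvPolynomial.aeval (fun i => ∑ j, MvPolynomial.C (M i j) * MvPolynomial.X j) p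

/-- Action of `g ∈ GL_N(ℂ)` on polynomials: `(g · p)(x) = p (g⁻¹ x)`. -/
def polyAct {N : ℕ} (g : Matrix.GeneralLinearGroup (Fin N) ℂ) (p : MvPolynomial (Fin N) ℂ) :
    MvPolynomial (Fin N) ℂ :=
  polyActM (↑(g⁻¹) : Matrix (Fin N) (Fin N) ℂ) p

/-- The linear polynomial with coefficient vector `a`. -/
def linPoly {N : ℕ} (a : Fin N → ℂ) : MvPolynomial (Fin N) ℂ :=
  ∑ i, MvPolynomial.C (a i) * MvPolynomial.X i

/-- The polynomial vector field `L = Σ f_i ∂_i` applied to a polynomial. -/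
def applyVF {N : ℕ} (f : Fin N → MvPolynomial (Fin N) ℂ) (p : MvPolynomial (Fin N) ℂ) :
    MvPolynomial (Fin N) ℂ :=
  ∑ i, f i * MvPolynomial.pderiv i p

/-- `g` is a (complex) reflection. -/
def IsReflection {N : ℕ} (g : Matrix.GeneralLinearGroup (Fin N) ℂ) : Prop :=
  ((↑g : Matrix (Fin N) (Fin N) ℂ) - 1).rank = 1

/-- The set `Q_m` of `m`-quasi-invariants. -/
def QmSet {N : ℕ} {A : Type} (s : A → Matrix.GeneralLinearGroup (Fin N) ℂ)
    (α : A → (Fin N → ℂ)) (n m : A → ℕ) : Set (MvPolynomial (Fin N) ℂ) :=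
  {p | ∀ H, linPoly (α H) ^ (m H * n H) ∣ p - polyAct (s H) p}

section PolyAct

variable {N : ℕ}

/-- `polyAct g` as an algebra homomorphism. -/
def polyActHom (g : Matrix.GeneralLinearGroup (Fin N) ℂ) :
    MvPolynomial (Fin N) ℂ →ₐ[ℂ] MvPolynomial (Fin N) ℂ :=
  MvPolynomial.aeval fun i =>
    ∑ j, MvPolynomial.C ((↑(g⁻¹) : Matrix (Fin N) (Fin N) ℂ) i j) * MvPolynomial.X j

theorem polyAct_eq_polyActHom (g : Matrix.GeneralLinearGroup (Fin N) ℂ)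
    (p : MvPolynomial (Fin N) ℂ) : polyAct g p = polyActHom g p := rfl

/-- `applyVF f` as a derivation. -/
def vfDerivation (f : Fin N → MvPolynomial (Fin N) ℂ) :
    Derivation ℂ (MvPolynomial (Fin N) ℂ) (MvPolynomial (Fin N) ℂ) :=
  ∑ i, f i • MvPolynomial.pderiv i

theorem applyVF_eq_vfDerivation (f : Fin N → MvPolynomial (Fin N) ℂ)
    (p : MvPolynomial (Fin N) ℂ) : applyVF f p = vfDerivation f p := by
  rw [vfDerivation, ← Derivation.coeFnAddMonoidHom_apply, map_sum, Finset.sum_apply]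
  rfl

theorem linPoly_smul (c : ℂ) (a : Fin N → ℂ) :
    linPoly (c • a) = MvPolynomial.C c * linPoly a := by
  simp [linPoly, Finset.mul_sum, mul_assoc]

theorem linPoly_add (a b : Fin N → ℂ) : linPoly (a + b) = linPoly a + linPoly b := by
  simp [linPoly, add_mul, Finset.sum_add_distrib]

theorem linPoly_single (i : Fin N) :
    linPoly (Pi.single i 1) = (MvPolynomial.X i : MvPolynomial (Fin N) ℂ) := by
  classical
  rw [linPoly, Finset.sum_eq_single i] <;> simp +contextual

theorem linPoly_ne_zero {a : Fin N → ℂ} (ha : a ≠ 0) : linPoly a ≠ 0 := by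
  classical
  intro h
  refine ha (funext fun i => ?_)
  have := congrArg (MvPolynomial.aeval (Pi.single i (1 : ℂ))) h
  simpa [linPoly, Pi.single_apply] using this

theorem polyAct_linPoly (g : Matrix.GeneralLinearGroup (Fin N) ℂ) (b : Fin N → ℂ) :
    polyAct g (linPoly b) =
      linPoly (Matrix.vecMul b (↑(g⁻¹) : Matrix (Fin N) (Fin N) ℂ)) := by
  rw [polyAct_eq_polyActHom]
  simp only [linPoly, polyActHom, map_sum, map_mul, MvPolynomial.aeval_X,
    MvPolynomial.aeval_C, MvPolynomial.algebraMap_eq, Matrix.vecMul, dotProduct,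
    Finset.mul_sum, Finset.sum_mul]
  rw [Finset.sum_comm]
  simp only [mul_assoc]

theorem polyAct_X (g : Matrix.GeneralLinearGroup (Fin N) ℂ) (i : Fin N) :
    polyAct g (MvPolynomial.X i) =
      linPoly (Matrix.vecMul (Pi.single i 1) (↑(g⁻¹) : Matrix (Fin N) (Fin N) ℂ)) := by
  rw [← linPoly_single, polyAct_linPoly]

theorem polyAct_polyAct_inv (g : Matrix.GeneralLinearGroup (Fin N) ℂ)
    (p : MvPolynomial (Fin N) ℂ) : polyAct g (polyAct g⁻¹ p) = p := by
  have h : (polyActHom g).comp (polyActHom g⁻¹) = AlgHom.id ℂ _ := by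
    refine MvPolynomial.algHom_ext fun i => ?_
    rw [AlgHom.comp_apply, ← polyAct_eq_polyActHom, ← polyAct_eq_polyActHom, polyAct_X,
      polyAct_linPoly, Matrix.vecMul_vecMul, ← Units.val_mul]
    simp [linPoly_single]
  exact DFunLike.congr_fun h p

theorem polyAct_inv_polyAct (g : Matrix.GeneralLinearGroup (Fin N) ℂ)
    (p : MvPolynomial (Fin N) ℂ) : polyAct g⁻¹ (polyAct g p) = p := by
  simpa using polyAct_polyAct_inv g⁻¹ p

theorem applyVF_linPoly (f : Fin N → MvPolynomial (Fin N) ℂ) (b : Fin N → ℂ) :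
    applyVF f (linPoly b) = ∑ i, b i • f i := by
  classical
  simp [applyVF, linPoly, MvPolynomial.pderiv_X, Pi.single_apply,
    MvPolynomial.smul_eq_C_mul, mul_comm]

theorem applyVF_linPoly_of_linearMap (φ : (Fin N → ℂ) →ₗ[ℂ] MvPolynomial (Fin N) ℂ)
    (b : Fin N → ℂ) : applyVF (fun i => φ (Pi.single i 1)) (linPoly b) = φ b := by
  rw [applyVF_linPoly]
  conv_rhs => rw [pi_eq_sum_univ' b, map_sum]
  refine Finset.sum_congr rfl fun i _ => ?_
  rw [← map_smul]

/-- A vector field is fixed by `g` as soon as it is so on the coordinate functions. -/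
theorem polyAct_applyVF_polyAct_inv (g : Matrix.GeneralLinearGroup (Fin N) ℂ)
    (f : Fin N → MvPolynomial (Fin N) ℂ)
    (h : ∀ i, polyAct g (applyVF f (polyAct g⁻¹ (MvPolynomial.X i))) = f i)
    (p : MvPolynomial (Fin N) ℂ) :
    polyAct g (applyVF f (polyAct g⁻¹ p)) = applyVF f p := by
  have hX : ∀ i, applyVF f (MvPolynomial.X i) = f i := fun i => by
    classical
    rw [← linPoly_single, applyVF_linPoly]
    simp [Pi.single_apply]
  have hinv := polyAct_polyAct_inv g
  simp only [polyAct_eq_polyActHom, applyVF_eq_vfDerivation] at h hX hinv ⊢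
  induction p using MvPolynomial.induction_on with
  | C a => simp [← MvPolynomial.algebraMap_eq]
  | add p q hp hq => simp only [map_add, hp, hq]
  | mul_X p i hp =>
    simp only [map_mul, Derivation.leibniz, map_add, smul_eq_mul, hp, h, hX, hinv]

end PolyAct

section Reflection

variable {N : ℕ} {s : Matrix.GeneralLinearGroup (Fin N) ℂ} {a av : Fin N → ℂ}

theorem vecMul_of_reflection
    (hform : ∀ v : Fin N → ℂ,
      (↑s : Matrix (Fin N) (Fin N) ℂ).mulVec v = v - (∑ i, a i * v i) • av)
    (b : Fin N → ℂ) :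
    Matrix.vecMul b (↑s : Matrix (Fin N) (Fin N) ℂ) = b - (b ⬝ᵥ av) • a := by
  have h : (↑s : Matrix (Fin N) (Fin N) ℂ) = 1 - Matrix.vecMulVec av a := by
    refine Matrix.ext_of_mulVec_single fun i => ?_
    rw [hform]
    ext j
    simp [Matrix.vecMulVec_apply, Matrix.one_apply, Pi.single_apply, mul_comm]
  rw [h, Matrix.vecMul_sub, Matrix.vecMul_one, Matrix.vecMul_vecMulVec]

theorem vecMul_reflection_pow
    (hform : ∀ v : Fin N → ℂ,
      (↑s : Matrix (Fin N) (Fin N) ℂ).mulVec v = v - (∑ i, a i * v i) • av) (k : ℕ) :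
    Matrix.vecMul a (↑(s ^ k) : Matrix (Fin N) (Fin N) ℂ) = (1 - a ⬝ᵥ av) ^ k • a := by
  induction k with
  | zero => simp
  | succ k ih =>
    rw [pow_succ, Units.val_mul, ← Matrix.vecMul_vecMul, ih, Matrix.smul_vecMul,
      vecMul_of_reflection hform]
    module

theorem reflection_eigenvalue_pow_orderOf (ha : a ≠ 0)
    (hform : ∀ v : Fin N → ℂ,
      (↑s : Matrix (Fin N) (Fin N) ℂ).mulVec v = v - (∑ i, a i * v i) • av) :
    (1 - a ⬝ᵥ av) ^ orderOf s = 1 := by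
  have h := vecMul_reflection_pow hform (orderOf s)
  rw [pow_orderOf_eq_one, Units.val_one, Matrix.vecMul_one] at h
  exact (smul_left_injective ℂ ha (by simpa using h)).symm

/-- A transvection has infinite order. -/
theorem dotProduct_ne_zero_of_reflection (ha : a ≠ 0) (hav : av ≠ 0) (ho : orderOf s ≠ 0)
    (hform : ∀ v : Fin N → ℂ,
      (↑s : Matrix (Fin N) (Fin N) ℂ).mulVec v = v - (∑ i, a i * v i) • av) :
    a ⬝ᵥ av ≠ 0 := by
  intro h0
  have hpow : ∀ (k : ℕ) (b : Fin N → ℂ),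
      Matrix.vecMul b (↑(s ^ k) : Matrix (Fin N) (Fin N) ℂ)
        = b - ((k : ℂ) * (b ⬝ᵥ av)) • a := by
    intro k b
    induction k with
    | zero => simp
    | succ k ih =>
      rw [pow_succ, Units.val_mul, ← Matrix.vecMul_vecMul, ih, vecMul_of_reflection hform,
        sub_dotProduct, smul_dotProduct, h0]
      push_cast
      module
  obtain ⟨i, hi⟩ := Function.ne_iff.mp hav
  have h := hpow (orderOf s) (Pi.single i 1)
  rw [pow_orderOf_eq_one, Units.val_one, Matrix.vecMul_one, eq_comm, sub_eq_self,
    smul_eq_zero_iff_left ha] at h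
  simp [ho] at h
  exact hi h

theorem vecMul_reflection_inv
    (hform : ∀ v : Fin N → ℂ,
      (↑s : Matrix (Fin N) (Fin N) ℂ).mulVec v = v - (∑ i, a i * v i) • av)
    (hl : 1 - a ⬝ᵥ av ≠ 0) (b : Fin N → ℂ) :
    Matrix.vecMul b (↑(s⁻¹) : Matrix (Fin N) (Fin N) ℂ)
      = b + ((1 - a ⬝ᵥ av)⁻¹ * (b ⬝ᵥ av)) • a := by
  have h : Matrix.vecMul (b + ((1 - a ⬝ᵥ av)⁻¹ * (b ⬝ᵥ av)) • a)
      (↑s : Matrix (Fin N) (Fin N) ℂ) = b := by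
    rw [Matrix.add_vecMul, Matrix.smul_vecMul, vecMul_of_reflection hform,
      vecMul_of_reflection hform]
    match_scalars
    · ring
    · field_simp
      ring
  conv_lhs => rw [← h]
  rw [Matrix.vecMul_vecMul, ← Units.val_mul, mul_inv_cancel, Units.val_one, Matrix.vecMul_one]

theorem vecMul_reflection_inv_self
    (hform : ∀ v : Fin N → ℂ,
      (↑s : Matrix (Fin N) (Fin N) ℂ).mulVec v = v - (∑ i, a i * v i) • av)
    (hl : 1 - a ⬝ᵥ av ≠ 0) :
    Matrix.vecMul a (↑(s⁻¹) : Matrix (Fin N) (Fin N) ℂ) = (1 - a ⬝ᵥ av)⁻¹ • a := by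
  rw [vecMul_reflection_inv hform hl]
  match_scalars
  field_simp
  ring

theorem linPoly_dvd_sub_polyAct
    (hform : ∀ v : Fin N → ℂ,
      (↑s : Matrix (Fin N) (Fin N) ℂ).mulVec v = v - (∑ i, a i * v i) • av)
    (hl : 1 - a ⬝ᵥ av ≠ 0) (p : MvPolynomial (Fin N) ℂ) :
    linPoly a ∣ p - polyAct s p := by
  have hX : ∀ i, linPoly a ∣ MvPolynomial.X i - polyAct s (MvPolynomial.X i) := fun i => by
    rw [polyAct_X, vecMul_reflection_inv hform hl, linPoly_add, linPoly_single, linPoly_smul,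
      sub_add_cancel_left]
    exact (dvd_mul_left _ _).neg_right
  simp only [polyAct_eq_polyActHom] at hX ⊢
  induction p using MvPolynomial.induction_on with
  | C c => simp [← MvPolynomial.algebraMap_eq]
  | add p q hp hq =>
    rw [map_add, add_sub_add_comm]
    exact dvd_add hp hq
  | mul_X p i hp =>
    rw [map_mul]
    exact dvd_mul_sub_mul hp (hX i)

/-- A polynomial with the same eigenvalue as `linPoly a` is divisible by one more power of
`linPoly a` than its quasi-invariance gives. -/
theorem linPoly_pow_succ_dvd (ha : a ≠ 0) (hav : a ⬝ᵥ av ≠ 0)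
    (hform : ∀ v : Fin N → ℂ,
      (↑s : Matrix (Fin N) (Fin N) ℂ).mulVec v = v - (∑ i, a i * v i) • av)
    (hl : 1 - a ⬝ᵥ av ≠ 0) {k : ℕ} (hk : (1 - a ⬝ᵥ av) ^ k = 1)
    {p : MvPolynomial (Fin N) ℂ}
    (hp : polyAct s p = MvPolynomial.C (1 - a ⬝ᵥ av)⁻¹ * p)
    (hdvd : linPoly a ^ k ∣ p - polyAct s p) : linPoly a ^ (k + 1) ∣ p := by
  have hunit : IsUnit (MvPolynomial.C (σ := Fin N) (1 - (1 - a ⬝ᵥ av)⁻¹)) := by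
    refine IsUnit.map _ (IsUnit.mk0 _ ?_)
    rw [sub_ne_zero, ne_comm, ne_eq, inv_eq_one]
    simpa using hav
  have hcancel : ∀ {d q : MvPolynomial (Fin N) ℂ},
      polyAct s q = MvPolynomial.C (1 - a ⬝ᵥ av)⁻¹ * q → d ∣ q - polyAct s q → d ∣ q := by
    intro d q hq hd
    rwa [hq, ← one_sub_mul, ← map_one MvPolynomial.C, ← map_sub, hunit.dvd_mul_left] at hd
  obtain ⟨q, rfl⟩ := hcancel hp hdvd
  have hlin : polyAct s (linPoly a ^ k) = linPoly a ^ k := by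
    rw [polyAct_eq_polyActHom, map_pow, ← polyAct_eq_polyActHom, polyAct_linPoly,
      vecMul_reflection_inv_self hform hl, linPoly_smul, mul_pow, ← map_pow, inv_pow, hk]
    simp
  have hq : polyAct s q = MvPolynomial.C (1 - a ⬝ᵥ av)⁻¹ * q := by
    refine mul_left_cancel₀ (pow_ne_zero k (linPoly_ne_zero ha)) ?_
    rw [mul_left_comm, ← hp]
    conv_lhs => rw [← hlin]
    simp only [polyAct_eq_polyActHom, map_mul]
  rw [pow_succ]
  exact mul_dvd_mul_left _ (hcancel hq (linPoly_dvd_sub_polyAct hform hl q))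

end Reflection

/-- the map `Θ : Hom_W(V*, Q_m) → D_m^W`, `Θ(φ) = Σ φ(x_i) ∂_i`, is a
well-defined bijection from the set of `W`-equivariant linear maps `V* → Q_m` onto the set
of `W`-invariant vector fields in `D_m`; its inverse sends `L = Σ f_i ∂_i` to `x_k ↦ f_k`.
Linear forms in `V*` are encoded by their coefficient vectors `b : Fin N → ℂ`, with
`W`-action `b ↦ vecMul b (g⁻¹)`, and `x_k` corresponds to `Pi.single k 1`. -/
theorem stmt_5 (N : ℕ) (hN : 0 < N)
    (W : Subgroup (Matrix.GeneralLinearGroup (Fin N) ℂ)) (hWfin : Finite W)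
    (hgen : Subgroup.closure {g | g ∈ W ∧ IsReflection g} = W)
    (hirr : ∀ U : Submodule ℂ (Fin N → ℂ),
      (∀ g ∈ W, ∀ v ∈ U, (↑g : Matrix (Fin N) (Fin N) ℂ).mulVec v ∈ U) → U = ⊥ ∨ U = ⊤)
    (A : Type)
    (s : A → Matrix.GeneralLinearGroup (Fin N) ℂ) (hsW : ∀ H, s H ∈ W)
    (n : A → ℕ) (hn2 : ∀ H, 2 ≤ n H) (horder : ∀ H, orderOf (s H) = n H)
    (α : A → (Fin N → ℂ)) (hα : ∀ H, α H ≠ 0)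
    (αv : A → (Fin N → ℂ)) (hαv : ∀ H, αv H ≠ 0)
    (hform : ∀ H (v : Fin N → ℂ),
      (↑(s H) : Matrix (Fin N) (Fin N) ℂ).mulVec v = v - (∑ i, α H i * v i) • αv H)
    (m : A → ℕ)
    (hminv : ∀ g ∈ W, ∀ H, ∃ H', (∃ c : ℂ, c ≠ 0 ∧
        α H' = c • Matrix.vecMul (α H) (↑(g⁻¹) : Matrix (Fin N) (Fin N) ℂ)) ∧ m H' = m H) :
    -- `Θ` is a bijection from `Hom_W(V*, Q_m)` onto `D_m^W`
    Set.BijOn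
      (fun (φ : (Fin N → ℂ) →ₗ[ℂ] MvPolynomial (Fin N) ℂ) => fun i => φ (Pi.single i 1))
      {φ : (Fin N → ℂ) →ₗ[ℂ] MvPolynomial (Fin N) ℂ |
        (∀ b, φ b ∈ QmSet s α n m) ∧
        (∀ g ∈ W, ∀ b, φ (Matrix.vecMul b (↑(g⁻¹) : Matrix (Fin N) (Fin N) ℂ))
          = polyAct g (φ b))}
      {f : Fin N → MvPolynomial (Fin N) ℂ |
        (∀ H, linPoly (α H) ^ (m H * n H + 1) ∣ applyVF f (linPoly (α H))) ∧
        (∀ g ∈ W, ∀ p, polyAct g (applyVF f (polyAct g⁻¹ p)) = applyVF f p)} ∧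
    -- the inverse sends `L = Σ f_i ∂_i` to the map determined by `x_k ↦ f_k`
    (∀ φ : (Fin N → ℂ) →ₗ[ℂ] MvPolynomial (Fin N) ℂ, ∀ f : Fin N → MvPolynomial (Fin N) ℂ,
      (fun i => φ (Pi.single i 1)) = f → ∀ k, φ (Pi.single k 1) = f k) := by
  have hord : ∀ H, orderOf (s H) ≠ 0 := fun H => by
    have := hn2 H
    rw [horder]
    lia
  have hroot : ∀ H, (1 - α H ⬝ᵥ αv H) ^ n H = 1 := fun H =>
    horder H ▸ reflection_eigenvalue_pow_orderOf (hα H) (hform H)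
  have hne : ∀ H, 1 - α H ⬝ᵥ αv H ≠ 0 := fun H h0 => by
    simpa [h0, ← horder H, hord H] using hroot H
  refine ⟨⟨?_, ?_, ?_⟩, fun φ f h k => congrFun h k⟩
  · rintro φ ⟨hQ, hW⟩
    refine ⟨fun H => ?_, fun g hg => polyAct_applyVF_polyAct_inv g _ fun i => ?_⟩
    · rw [applyVF_linPoly_of_linearMap]
      refine linPoly_pow_succ_dvd (hα H)
        (dotProduct_ne_zero_of_reflection (hα H) (hαv H) (hord H) (hform H)) (hform H) (hne H)
        (by rw [mul_comm, pow_mul, hroot, one_pow]) ?_ (hQ (α H) H)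
      rw [← hW _ (hsW H), vecMul_reflection_inv_self (hform H) (hne H), map_smul,
        MvPolynomial.smul_eq_C_mul]
    · rw [polyAct_X, applyVF_linPoly_of_linearMap, hW _ (inv_mem hg), polyAct_polyAct_inv]
  · intro φ _ ψ _ h
    refine LinearMap.pi_ext' fun i => LinearMap.ext_ring ?_
    simpa using congrFun h i
  · rintro f ⟨hD, hW⟩
    have hφ : ∀ b, Fintype.linearCombination ℂ f b = applyVF f (linPoly b) := fun b => by
      rw [applyVF_linPoly, Fintype.linearCombination_apply]
    have hequiv : ∀ g ∈ W, ∀ b,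
        Fintype.linearCombination ℂ f
            (Matrix.vecMul b (↑(g⁻¹) : Matrix (Fin N) (Fin N) ℂ))
          = polyAct g (Fintype.linearCombination ℂ f b) := fun g hg b => by
      rw [hφ, hφ, ← polyAct_linPoly, ← hW g hg, polyAct_inv_polyAct]
    refine ⟨Fintype.linearCombination ℂ f, ⟨fun b H => ?_, hequiv⟩, ?_⟩
    · rw [← hequiv _ (hsW H), vecMul_reflection_inv (hform H) (hne H), map_add,
        sub_add_cancel_left, map_smul, hφ (α H), MvPolynomial.smul_eq_C_mul]
      exact (((pow_dvd_pow _ (Nat.le_succ _)).trans (hD H)).mul_left _).neg_right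
    · funext i
      simp [Fintype.linearCombination_apply_single]

end
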